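/- Let X be a compact metric space, F a nonempty set of bounded continuous real-valued functions on X×X, and τ the adversarial divergence over X determined by F. Let μ* be a Borel probability measure on X and (μₙ) a sequence of Borel probability measures on X. If τ(μ*||μₙ) → inf_{μ'∈P(X)} τ(μ*||μ'), then (μₙ) weakly converges to the set OPT_{τ,μ*}; equivalently, for every weak-* open subset U of P(X) containing OPT_{τ,μ*}, μₙ ∈ U for all sufficiently large n. -/

import Mathlib

open MeasureTheory Filter Topology

/-- The adversarial divergence over `X` determined by a family `F` of bounded continuous
functions on `X × X`: `τ(μ‖ν) = sup_{f ∈ F} E_{μ⊗ν}[f]`, with values in `ℝ ∪ {±∞}`. -/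
noncomputable def advDiv {X : Type*} [TopologicalSpace X] [MeasurableSpace X]
    (F : Set (BoundedContinuousFunction (X × X) ℝ))
    (μ ν : ProbabilityMeasure X) : EReal :=
  ⨆ f ∈ F, (((∫ p, f p ∂((μ : Measure X).prod (ν : Measure X))) : ℝ) : EReal)

/-- The adversarial divergence is weak-* lower semicontinuous in its second argument. -/
theorem lowerSemicontinuous_advDiv {X : Type*} [TopologicalSpace X] [SecondCountableTopology X]
    [TopologicalSpace.PseudoMetrizableSpace X] [MeasurableSpace X] [BorelSpace X]
    (F : Set (BoundedContinuousFunction (X × X) ℝ)) (μ : ProbabilityMeasure X) :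
    LowerSemicontinuous (advDiv F μ) := by
  refine lowerSemicontinuous_biSup fun f _ => Continuous.lowerSemicontinuous ?_
  have hprod : Continuous fun ν : ProbabilityMeasure X => μ.prod ν :=
    ProbabilityMeasure.continuous_prod.comp (Continuous.prodMk_right μ)
  exact continuous_coe_real_ereal.comp
    ((ProbabilityMeasure.continuous_integral_boundedContinuousFunction f).comp hprod)

/-- On a compact metric space, if `τ(μ*‖μₙ)` converges to the global infimum
of `τ(μ*‖·)`, then `(μₙ)` weakly converges to the set `OPT_{τ,μ*}`: every weak-* open set
`U ⊆ P(X)` containing `OPT_{τ,μ*}` eventually contains `μₙ`. (Here `ProbabilityMeasure X`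
carries the topology of weak convergence.) -/
theorem stmt6 {X : Type*} [MetricSpace X] [CompactSpace X]
    [MeasurableSpace X] [BorelSpace X]
    (F : Set (BoundedContinuousFunction (X × X) ℝ)) (hF : F.Nonempty)
    (μstar : ProbabilityMeasure X) (μs : ℕ → ProbabilityMeasure X)
    (hconv : Tendsto (fun k => advDiv F μstar (μs k)) atTop
      (𝓝 (⨅ μ' : ProbabilityMeasure X, advDiv F μstar μ'))) :
    ∀ U : Set (ProbabilityMeasure X), IsOpen U →
      {μ : ProbabilityMeasure X |
        advDiv F μstar μ = ⨅ μ' : ProbabilityMeasure X, advDiv F μstar μ'} ⊆ U →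
      ∀ᶠ k in atTop, μs k ∈ U := by
  intro U hU hopt
  rcases (Uᶜ).eq_empty_or_nonempty with hempty | hne
  · simp [Set.compl_empty_iff.mp hempty]
  obtain ⟨ν, hν, hmin⟩ := LowerSemicontinuousOn.exists_isMinOn hne hU.isClosed_compl.isCompact
    ((lowerSemicontinuous_advDiv F μstar).lowerSemicontinuousOn _)
  have hlt : ⨅ μ' : ProbabilityMeasure X, advDiv F μstar μ' < advDiv F μstar ν :=
    (iInf_le _ ν).lt_of_ne fun h => hν (hopt h.symm)
  filter_upwards [hconv.eventually_lt_const hlt] with k hk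
  by_contra hkU
  exact (hmin hkU).not_gt hk
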